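/- Fix μ₁, μ₂ ∈ ℝ and σ₁, σ₂ > 0 with (μ₁, σ₁) ≠ (μ₂, σ₂), and let BC(κ) be defined for κ ≥ 0 as BC(κ) = exp( −¼·ln( ¼·( (σ₁² + κ)/(σ₂² + κ) + (σ₂² + κ)/(σ₁² + κ) + 2 ) ) − ¼·(μ₁ − μ₂)²/(σ₁² + σ₂² + 2κ) ). Then BC(0) < 1, and for every κ′ ∈ (0, 1 − BC(0)) the equation BC(κ) − BC(0) = κ′ has a unique solution κ ∈ (0, ∞). -/

import Mathlib

open Filter Topology

/-- The exponent of the Bhattacharyya coefficient of two Gaussians with variances `a + κ`, `b + κ`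
and squared distance `c` between their means, with its logarithm's argument simplified. -/
noncomputable def bhattacharyyaExponent (a b c κ : ℝ) : ℝ :=
  -(1 / 4) * Real.log (1 + (a - b) ^ 2 / (4 * ((a + κ) * (b + κ)))) -
    (1 / 4) * (c / (a + b + 2 * κ))

lemma quarter_mul_div_add_div_add_two {x y : ℝ} (hx : 0 < x) (hy : 0 < y) :
    (1 / 4) * (x / y + y / x + 2) = 1 + (x - y) ^ 2 / (4 * (x * y)) := by
  field_simp
  ring

section

variable {a b c : ℝ}

lemma bhattacharyyaExponent_neg (ha : 0 < a) (hb : 0 < b) (hc : 0 ≤ c)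
    (h : a ≠ b ∨ 0 < c) {κ : ℝ} (hκ : 0 ≤ κ) : bhattacharyyaExponent a b c κ < 0 := by
  unfold bhattacharyyaExponent
  have hp : 0 < 4 * ((a + κ) * (b + κ)) := by positivity
  have hq : 0 < a + b + 2 * κ := by positivity
  have hlog : 0 ≤ Real.log (1 + (a - b) ^ 2 / (4 * ((a + κ) * (b + κ)))) :=
    Real.log_nonneg (le_add_of_nonneg_right (by positivity))
  have hdiv : 0 ≤ c / (a + b + 2 * κ) := by positivity
  rcases h with hab | hc'
  · have hab' : 0 < (a - b) ^ 2 := by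
      have := sub_ne_zero.mpr hab
      positivity
    have : 0 < Real.log (1 + (a - b) ^ 2 / (4 * ((a + κ) * (b + κ)))) :=
      Real.log_pos (lt_add_of_pos_right _ (by positivity))
    linarith
  · have : 0 < c / (a + b + 2 * κ) := by positivity
    linarith

lemma strictMonoOn_bhattacharyyaExponent (ha : 0 < a) (hb : 0 < b) (hc : 0 ≤ c)
    (h : a ≠ b ∨ 0 < c) : StrictMonoOn (bhattacharyyaExponent a b c) (Set.Ici 0) := by
  intro x hx y hy hxy
  rw [Set.mem_Ici] at hx hy
  unfold bhattacharyyaExponent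
  have hpx : 0 < 4 * ((a + x) * (b + x)) := by positivity
  have hpy : 0 < 4 * ((a + y) * (b + y)) := by positivity
  have hp : 4 * ((a + x) * (b + x)) < 4 * ((a + y) * (b + y)) := by gcongr
  have hqx : 0 < a + b + 2 * x := by positivity
  have hq : a + b + 2 * x < a + b + 2 * y := by gcongr
  have hlog : Real.log (1 + (a - b) ^ 2 / (4 * ((a + y) * (b + y)))) ≤
      Real.log (1 + (a - b) ^ 2 / (4 * ((a + x) * (b + x)))) :=
    Real.log_le_log (by positivity)
      (add_le_add_right (div_le_div_of_nonneg_left (sq_nonneg _) hpx hp.le) _)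
  have hdiv : c / (a + b + 2 * y) ≤ c / (a + b + 2 * x) :=
    div_le_div_of_nonneg_left hc hqx hq.le
  rcases h with hab | hc'
  · have hab' : 0 < (a - b) ^ 2 := by
      have := sub_ne_zero.mpr hab
      positivity
    have : Real.log (1 + (a - b) ^ 2 / (4 * ((a + y) * (b + y)))) <
        Real.log (1 + (a - b) ^ 2 / (4 * ((a + x) * (b + x)))) :=
      Real.log_lt_log (by positivity)
        (add_lt_add_right (div_lt_div_of_pos_left hab' hpx hp) _)
    linarith
  · have : c / (a + b + 2 * y) < c / (a + b + 2 * x) := div_lt_div_of_pos_left hc' hqx hq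
    linarith

lemma continuousOn_bhattacharyyaExponent (ha : 0 < a) (hb : 0 < b) :
    ContinuousOn (bhattacharyyaExponent a b c) (Set.Ici 0) := by
  intro x hx
  rw [Set.mem_Ici] at hx
  have hp : 4 * ((a + x) * (b + x)) ≠ 0 := by positivity
  have hq : a + b + 2 * x ≠ 0 := by positivity
  have hr : 1 + (a - b) ^ 2 / (4 * ((a + x) * (b + x))) ≠ 0 := by positivity
  have : ContinuousAt (bhattacharyyaExponent a b c) x := by
    unfold bhattacharyyaExponent
    fun_prop (disch := assumption)
  exact this.continuousWithinAt

lemma tendsto_bhattacharyyaExponent_atTop (a b c : ℝ) :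
    Tendsto (bhattacharyyaExponent a b c) atTop (𝓝 0) := by
  have hadd (t : ℝ) : Tendsto (fun κ : ℝ => t + κ) atTop atTop :=
    tendsto_atTop_add_const_left _ _ tendsto_id
  have hp : Tendsto (fun κ => 1 + (a - b) ^ 2 / (4 * ((a + κ) * (b + κ)))) atTop (𝓝 (1 + 0)) :=
    (Tendsto.const_div_atTop
      (((hadd a).atTop_mul_atTop₀ (hadd b)).const_mul_atTop (by norm_num)) _).const_add 1
  have hq : Tendsto (fun κ : ℝ => c / (a + b + 2 * κ)) atTop (𝓝 0) :=
    Tendsto.const_div_atTop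
      (tendsto_atTop_add_const_left _ _ (tendsto_id.const_mul_atTop (by norm_num))) _
  have := ((hp.log (by norm_num)).const_mul (-(1 / 4))).sub (hq.const_mul (1 / 4))
  unfold bhattacharyyaExponent
  simpa using this

end

/-- Well-posedness of the adaptive regularization equation: with
`BC(κ)` the Bhattacharyya coefficient of `N(μ₁, σ₁²+κ)` and `N(μ₂, σ₂²+κ)` and
`(μ₁, σ₁) ≠ (μ₂, σ₂)`, we have `BC(0) < 1`, and for every `κ′ ∈ (0, 1 − BC(0))`
the equation `BC(κ) − BC(0) = κ′` has a unique solution `κ ∈ (0,∞)`. -/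
theorem adaptive_regularization_wellposed (μ1 μ2 σ1 σ2 : ℝ)
    (h1 : 0 < σ1) (h2 : 0 < σ2) (hne : (μ1, σ1) ≠ (μ2, σ2))
    (BC : ℝ → ℝ)
    (hBC : ∀ κ, BC κ = Real.exp (
      -(1 / 4) * Real.log ((1 / 4) * ((σ1 ^ 2 + κ) / (σ2 ^ 2 + κ) +
        (σ2 ^ 2 + κ) / (σ1 ^ 2 + κ) + 2)) -
      (1 / 4) * (μ1 - μ2) ^ 2 / (σ1 ^ 2 + σ2 ^ 2 + 2 * κ))) :
    BC 0 < 1 ∧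
      ∀ κ' ∈ Set.Ioo (0:ℝ) (1 - BC 0), ∃! κ, κ ∈ Set.Ioi (0:ℝ) ∧ BC κ - BC 0 = κ' := by
  have ha : 0 < σ1 ^ 2 := by positivity
  have hb : 0 < σ2 ^ 2 := by positivity
  have hc : 0 ≤ (μ1 - μ2) ^ 2 := sq_nonneg _
  have hdist : σ1 ^ 2 ≠ σ2 ^ 2 ∨ 0 < (μ1 - μ2) ^ 2 := by
    by_cases hμ : μ1 = μ2
    · left
      intro hσ
      exact hne (Prod.ext hμ ((sq_eq_sq₀ h1.le h2.le).mp hσ))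
    · right
      have := sub_ne_zero.mpr hμ
      positivity
  set E := bhattacharyyaExponent (σ1 ^ 2) (σ2 ^ 2) ((μ1 - μ2) ^ 2) with hE
  have hBCE : Set.EqOn BC (fun κ => Real.exp (E κ)) (Set.Ici 0) := by
    intro κ hκ
    rw [Set.mem_Ici] at hκ
    simp only [hBC, hE, bhattacharyyaExponent]
    rw [quarter_mul_div_add_div_add_two (by positivity) (by positivity),
      add_sub_add_right_eq_sub, mul_div_assoc]
  have hmono : StrictMonoOn BC (Set.Ici 0) :=
    (Real.exp_strictMono.comp_strictMonoOn
      (strictMonoOn_bhattacharyyaExponent ha hb hc hdist)).congr hBCE.symm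
  have hcont : ContinuousOn BC (Set.Ici 0) :=
    (continuousOn_bhattacharyyaExponent ha hb).rexp.congr hBCE
  have hlim : Tendsto BC atTop (𝓝 1) := by
    rw [← Real.exp_zero]
    exact (tendsto_bhattacharyyaExponent_atTop _ _ _).rexp.congr'
      ((eventually_ge_atTop 0).mono fun κ hκ => (hBCE hκ).symm)
  refine ⟨?_, ?_⟩
  · rw [hBCE Set.self_mem_Ici]
    exact Real.exp_lt_one_iff.2 (bhattacharyyaExponent_neg ha hb hc hdist le_rfl)
  · rintro κ' ⟨hpos, hlt⟩
    obtain ⟨K, hK, hK0⟩ := ((hlim.eventually_const_lt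
      (show BC 0 + κ' < 1 by linarith)).and (eventually_gt_atTop 0)).exists
    obtain ⟨κ, hκ, hκe⟩ := intermediate_value_Ioo hK0.le (hcont.mono Set.Icc_subset_Ici_self)
      (show BC 0 + κ' ∈ Set.Ioo (BC 0) (BC K) from ⟨by linarith, hK⟩)
    refine ⟨κ, ⟨hκ.1, by linarith⟩, ?_⟩
    rintro y ⟨hy, hye⟩
    exact hmono.injOn (Set.Ioi_subset_Ici_self hy) (Set.Ioi_subset_Ici_self hκ.1) (by linarith)
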